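/- There is no wandering gap of exponential combinatorial type: there exists no set A ⊆ ℤ^ℕ such that σⁿ(A) has at least 3 elements for all n ≥ 0 and such that the sets σ^{n₁}(A) + m₁ and σ^{n₂}(A) + m₂ are disjoint and unlinked whenever (n₁, m₁) ≠ (n₂, m₂), where n₁, n₂ ≥ 0 and m₁, m₂ ∈ ℤ. -/

import Mathlib

open Set Filter Topology

/-- The space of external addresses: integer sequences `s₀ s₁ s₂ …`. -/
abbrev Addr : Type := ℕ → ℤ

/-- The one-sided shift on external addresses. -/
def shift (s : Addr) : Addr := fun n => s (n + 1)

/-- Strict lexicographic order on external addresses. -/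
def lexLt (a b : Addr) : Prop := ∃ n : ℕ, (∀ m : ℕ, m < n → a m = b m) ∧ a n < b n

/-- Two sets of addresses are linked if they alternate somewhere in lexicographic order. -/
def Linked (A B : Set Addr) : Prop :=
  ∃ a₁ ∈ A, ∃ a₂ ∈ A, ∃ b₁ ∈ B, ∃ b₂ ∈ B,
    (lexLt a₁ b₁ ∧ lexLt b₁ a₂ ∧ lexLt a₂ b₂) ∨ (lexLt b₁ a₁ ∧ lexLt a₁ b₂ ∧ lexLt b₂ a₂)

/-- Two sets of addresses are unlinked if they are disjoint and not linked. -/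
def Unlinked (A B : Set Addr) : Prop := Disjoint A B ∧ ¬ Linked A B

/-- The translate `m + A`: add `m` to the first entry of every element of `A`. -/
def translateSet (m : ℤ) (A : Set Addr) : Set Addr :=
  (fun r : Addr => Function.update r 0 (r 0 + m)) '' A

/-- The image `σⁿ(A)` of a set of addresses under the `n`-th iterate of the shift. -/
def shiftSet (n : ℕ) (A : Set Addr) : Set Addr := (fun s => shift^[n] s) '' A

theorem toLex_lt_iff_lexLt {a b : Addr} : toLex a < toLex b ↔ lexLt a b := Iff.rfl

/-- The lexicographic order compares first entries, then tails. -/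
theorem toLex_lt_iff_head_tail {a b : Addr} :
    toLex a < toLex b ↔ a 0 < b 0 ∨ (a 0 = b 0 ∧ toLex (shift a) < toLex (shift b)) := by
  simp only [toLex_lt_iff_lexLt]
  constructor
  · rintro ⟨n, hn, h⟩
    cases n with
    | zero => exact Or.inl h
    | succ n =>
      exact Or.inr ⟨hn 0 n.succ_pos, n, fun m hm => hn (m + 1) (by omega), h⟩
  · rintro (h | ⟨h0, n, hn, h⟩)
    · exact ⟨0, fun m hm => absurd hm m.not_lt_zero, h⟩
    · refine ⟨n + 1, fun m hm => ?_, h⟩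
      cases m with
      | zero => exact h0
      | succ m => exact hn m (by omega)

/-- An address between two addresses with a common prefix shares that prefix. -/
theorem eq_prefix_of_between {a b c : Addr} {r : ℕ} (hab : toLex a < toLex b)
    (hbc : toLex b < toLex c) (hac : ∀ t < r, a t = c t) : ∀ t < r, b t = a t := by
  obtain ⟨n, hn, hlt⟩ := hab
  obtain ⟨k, hk, hlt'⟩ := hbc
  simp only [Pi.toLex_apply] at hn hlt hk hlt'
  intro t ht
  rcases lt_or_ge t n with h | h
  · exact (hn t h).symm
  · exfalso
    rcases lt_trichotomy n k with h1 | h1 | h1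
    · have := hk n h1
      have := hac n (by omega)
      omega
    · subst h1
      have := hac n (by omega)
      omega
    · have := hn k h1
      have := hac k (by omega)
      omega

/-- Addition of `m` to the first entry of an address. -/
def addHead (m : ℤ) (a : Addr) : Addr := Function.update a 0 (a 0 + m)

@[simp] theorem addHead_head (m : ℤ) (a : Addr) : addHead m a 0 = a 0 + m := by
  simp [addHead]

@[simp] theorem shift_addHead (m : ℤ) (a : Addr) : shift (addHead m a) = shift a := by
  funext n
  simp [addHead, shift]

@[simp] theorem addHead_zero (a : Addr) : addHead 0 a = a := by
  simp [addHead]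

/-- The address `σⁿ(pᵢ)`. -/
def orbit (p : Fin 3 → Addr) (n : ℕ) (i : Fin 3) : Addr := fun k => p i (n + k)

theorem shift_iterate (n : ℕ) (s : Addr) : shift^[n] s = fun k => s (n + k) := by
  induction n generalizing s with
  | zero => simp
  | succ n ih =>
    rw [Function.iterate_succ_apply, ih]
    funext k
    simp only [shift]
    congr 1
    omega

@[simp] theorem orbit_head (p : Fin 3 → Addr) (n : ℕ) (i : Fin 3) : orbit p n i 0 = p i n := rfl

@[simp] theorem shift_orbit (p : Fin 3 → Addr) (n : ℕ) (i : Fin 3) :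
    shift (orbit p n i) = orbit p (n + 1) i := by
  funext k
  simp only [orbit, shift]
  congr 1
  omega

/-- Three distinct points whose orbit triples, together with all their translates, are pairwise
disjoint and unlinked. -/
structure WanderingTriple (p : Fin 3 → Addr) : Prop where
  injective : Function.Injective p
  ne : ∀ (n₁ n₂ : ℕ) (m₁ m₂ : ℤ), (n₁, m₁) ≠ (n₂, m₂) → ∀ i j,
    addHead m₁ (orbit p n₁ i) ≠ addHead m₂ (orbit p n₂ j)
  not_alternating : ∀ (n₁ n₂ : ℕ) (m₁ m₂ : ℤ), (n₁, m₁) ≠ (n₂, m₂) → ∀ i i' j j',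
    toLex (addHead m₁ (orbit p n₁ i)) < toLex (addHead m₂ (orbit p n₂ j)) →
    toLex (addHead m₂ (orbit p n₂ j)) < toLex (addHead m₁ (orbit p n₁ i')) →
    ¬ toLex (addHead m₁ (orbit p n₁ i')) < toLex (addHead m₂ (orbit p n₂ j'))

/-- At time `n` the point `x` is the smallest and `z` the largest of the three points. -/
def MinMax (p : Fin 3 → Addr) (n : ℕ) (x z : Fin 3) : Prop :=
  ∀ v, toLex (orbit p n x) ≤ toLex (orbit p n v) ∧ toLex (orbit p n v) ≤ toLex (orbit p n z)

/-- At time `n` the point `w` lies strictly between the points `i` and `u`. -/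
def Separates (p : Fin 3 → Addr) (n : ℕ) (w i u : Fin 3) : Prop :=
  (toLex (orbit p n i) < toLex (orbit p n w) ∧ toLex (orbit p n w) < toLex (orbit p n u)) ∨
  (toLex (orbit p n u) < toLex (orbit p n w) ∧ toLex (orbit p n w) < toLex (orbit p n i))

/-- At time `n` the three first entries are not all equal. -/
def Splits (p : Fin 3 → Addr) (n : ℕ) : Prop := ∃ i j, p i n ≠ p j n

/-- At time `n` the first entries split, and the extremal points coincide in exactly the `r`
entries after the first. -/
def HasDepth (p : Fin 3 → Addr) (n r : ℕ) : Prop :=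
  ∃ x z, MinMax p n x z ∧ p x n < p z n ∧
    (∀ t < r, p x (n + 1 + t) = p z (n + 1 + t)) ∧ p x (n + 1 + r) ≠ p z (n + 1 + r)

theorem Separates.symm {p : Fin 3 → Addr} {n : ℕ} {w i u : Fin 3} (h : Separates p n w i u) :
    Separates p n w u i :=
  Or.symm h

theorem exists_minMax (p : Fin 3 → Addr) (n : ℕ) : ∃ x z, MinMax p n x z := by
  obtain ⟨x, hx⟩ := Finite.exists_min (fun v => toLex (orbit p n v))
  obtain ⟨z, hz⟩ := Finite.exists_max (fun v => toLex (orbit p n v))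
  exact ⟨x, z, fun v => ⟨hx v, hz v⟩⟩

theorem Separates.minMax {p : Fin 3 → Addr} {n : ℕ} {w i u : Fin 3} (h : Separates p n w i u) :
    MinMax p n i u ∨ MinMax p n u i := by
  have fin_three : ∀ w i u : Fin 3, w ≠ i → w ≠ u → i ≠ u → ∀ v, v = i ∨ v = u ∨ v = w := by
    decide
  have cover := fin_three w i u
    (by rintro rfl; exact h.elim (fun h => lt_irrefl _ h.1) fun h => lt_irrefl _ h.2)
    (by rintro rfl; exact h.elim (fun h => lt_irrefl _ h.2) fun h => lt_irrefl _ h.1)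
    (by rintro rfl; rcases h with h | h <;> exact lt_asymm h.1 h.2)
  rcases h with h | h
  · refine Or.inl fun v => ?_
    rcases cover v with rfl | rfl | rfl
    exacts [⟨le_rfl, (h.1.trans h.2).le⟩, ⟨(h.1.trans h.2).le, le_rfl⟩, ⟨h.1.le, h.2.le⟩]
  · refine Or.inr fun v => ?_
    rcases cover v with rfl | rfl | rfl
    exacts [⟨(h.1.trans h.2).le, le_rfl⟩, ⟨le_rfl, (h.1.trans h.2).le⟩, ⟨h.1.le, h.2.le⟩]

section

variable {p : Fin 3 → Addr}

theorem orbit_lt_iff_of_head_eq {n : ℕ} {i j : Fin 3} (h : p i n = p j n) :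
    toLex (orbit p n i) < toLex (orbit p n j) ↔
      toLex (orbit p (n + 1) i) < toLex (orbit p (n + 1) j) := by
  rw [toLex_lt_iff_head_tail]
  simp [h]

theorem orbit_lt_of_head_lt {n : ℕ} {i j : Fin 3} (h : p i n < p j n) :
    toLex (orbit p n i) < toLex (orbit p n j) := by
  rw [toLex_lt_iff_head_tail]
  exact Or.inl h

theorem head_le_of_orbit_lt {n : ℕ} {i j : Fin 3} (h : toLex (orbit p n i) < toLex (orbit p n j)) :
    p i n ≤ p j n := by
  by_contra hc
  exact lt_asymm h (orbit_lt_of_head_lt (not_le.mp hc))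

theorem Separates.succ {n : ℕ} {w i u : Fin 3} (hs : Separates p n w i u)
    (h : p i n = p u n) : Separates p (n + 1) w i u := by
  have hw : p w n = p i n := by
    rcases hs with hs | hs <;>
    · have := head_le_of_orbit_lt hs.1
      have := head_le_of_orbit_lt hs.2
      omega
  rcases hs with hs | hs
  · exact Or.inl ⟨(orbit_lt_iff_of_head_eq hw.symm).1 hs.1,
      (orbit_lt_iff_of_head_eq (hw.trans h)).1 hs.2⟩
  · exact Or.inr ⟨(orbit_lt_iff_of_head_eq (hw.trans h).symm).1 hs.1,
      (orbit_lt_iff_of_head_eq hw).1 hs.2⟩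

theorem MinMax.head_lt {n : ℕ} {x z : Fin 3} (hxz : MinMax p n x z) (hs : Splits p n) :
    p x n < p z n := by
  have le : ∀ v, p x n ≤ p v n ∧ p v n ≤ p z n := fun v => by
    constructor
    · by_contra hc
      exact absurd (orbit_lt_of_head_lt (not_le.mp hc)) (not_lt.mpr (hxz v).1)
    · by_contra hc
      exact absurd (orbit_lt_of_head_lt (not_le.mp hc)) (not_lt.mpr (hxz v).2)
  obtain ⟨i, j, hij⟩ := hs
  have := le i
  have := le j
  omega

theorem HasDepth.splits {n r : ℕ} (h : HasDepth p n r) : Splits p n := by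
  obtain ⟨x, z, -, hlt, -⟩ := h
  exact ⟨x, z, hlt.ne⟩

theorem HasDepth.le_of_agree {n r s : ℕ} (h : HasDepth p n r)
    (hag : ∀ i j, ∀ t < s, p i (n + 1 + t) = p j (n + 1 + t)) : s ≤ r := by
  obtain ⟨x, z, -, -, -, hne⟩ := h
  by_contra! hlt
  exact hne (hag x z r hlt)

end

namespace WanderingTriple

variable {p : Fin 3 → Addr}

theorem lt_addHead_one (hp : WanderingTriple p) (n : ℕ) (i j : Fin 3) :
    toLex (orbit p n i) < toLex (addHead 1 (orbit p n j)) := by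
  have up : ∀ v, toLex (orbit p n v) < toLex (addHead 1 (orbit p n v)) := fun v => by
    rw [toLex_lt_iff_head_tail]
    left
    simp
  by_contra hcon
  have hne : addHead 1 (orbit p n j) ≠ orbit p n i := by
    simpa using hp.ne n n 1 0 (by simp) j i
  have hlt : toLex (addHead 1 (orbit p n j)) < toLex (orbit p n i) :=
    lt_of_le_of_ne (not_lt.mp hcon) fun h => hne (toLex.injective h)
  have := hp.not_alternating n n 0 1 (by simp) j i j i
  simp only [addHead_zero] at this
  exact this (up j) hlt (up i)

theorem orbit_injective (hp : WanderingTriple p) (n : ℕ) :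
    Function.Injective (fun i => toLex (orbit p n i)) := by
  induction n with
  | zero =>
    intro i j h
    refine hp.injective (funext fun k => ?_)
    simpa [orbit] using congrFun (toLex.injective h) k
  | succ n ih =>
    intro i j h
    have h' : shift (orbit p n i) = shift (orbit p n j) := by
      simpa using toLex.injective h
    have key : addHead (p j n - p i n) (orbit p n i) = addHead 0 (orbit p n j) := by
      funext k
      cases k with
      | zero => simp
      | succ k => simpa [addHead, shift] using congrFun h' k
    by_cases hd : p j n - p i n = 0
    · rw [hd] at key
      apply ih
      simpa using key
    · exact (hp.ne n n _ _ (by simpa using hd) i j key).elim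

theorem head_le (hp : WanderingTriple p) (n : ℕ) (i j : Fin 3) : p i n ≤ p j n + 1 := by
  have := hp.lt_addHead_one n i j
  rw [toLex_lt_iff_head_tail] at this
  simp only [addHead_head, orbit_head] at this
  omega

/-- The shift reverses the order of two points of a triple whose first entries differ. -/
theorem shift_lt_of_head_lt (hp : WanderingTriple p) {n : ℕ} {i j : Fin 3} (h : p i n < p j n) :
    toLex (orbit p (n + 1) j) < toLex (orbit p (n + 1) i) := by
  have := hp.lt_addHead_one n j i
  rw [toLex_lt_iff_head_tail] at this
  simp only [addHead_head, orbit_head, shift_addHead, shift_orbit] at this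
  rcases this with h' | h'
  · omega
  · exact h'.2

theorem separates_or_separates_succ_of_head_lt (hp : WanderingTriple p) {n : ℕ} {w i u : Fin 3}
    (hwi : w ≠ i) (hwu : w ≠ u) (h : p i n < p u n) :
    Separates p n w i u ∨ Separates p (n + 1) w i u := by
  have hwi' : toLex (orbit p n w) ≠ toLex (orbit p n i) := (hp.orbit_injective n).ne hwi
  have hwu' : toLex (orbit p n w) ≠ toLex (orbit p n u) := (hp.orbit_injective n).ne hwu
  have h1 := hp.head_le n u w
  have h2 := hp.head_le n w i
  have h3 := hp.head_le n u i
  rcases lt_or_gt_of_ne hwi' with hlt | hgt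
  · have hw : p w n = p i n := by
      have := head_le_of_orbit_lt hlt
      omega
    exact Or.inr (Or.inr ⟨hp.shift_lt_of_head_lt (by omega), (orbit_lt_iff_of_head_eq hw).1 hlt⟩)
  · rcases lt_or_gt_of_ne hwu' with hlt' | hgt'
    · exact Or.inl (Or.inl ⟨hgt, hlt'⟩)
    · have hw : p u n = p w n := by
        have := head_le_of_orbit_lt hgt'
        omega
      exact Or.inr (Or.inr ⟨(orbit_lt_iff_of_head_eq hw).1 hgt', hp.shift_lt_of_head_lt (by omega)⟩)

theorem separates_or_separates_succ (hp : WanderingTriple p) {n : ℕ} {w i u : Fin 3}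
    (hwi : w ≠ i) (hwu : w ≠ u) (h : p i n ≠ p u n) :
    Separates p n w i u ∨ Separates p (n + 1) w i u := by
  rcases lt_or_gt_of_ne h with h | h
  · exact hp.separates_or_separates_succ_of_head_lt hwi hwu h
  · exact (hp.separates_or_separates_succ_of_head_lt hwu hwi h).imp Separates.symm Separates.symm

theorem exists_head_ne (hp : WanderingTriple p) {i j : Fin 3} (hij : i ≠ j) (N : ℕ) :
    ∃ t, p i (N + t) ≠ p j (N + t) := by
  by_contra! h
  exact (hp.orbit_injective N).ne hij (congrArg toLex (funext h))

theorem exists_hasDepth (hp : WanderingTriple p) {n : ℕ} (hs : Splits p n) :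
    ∃ r, HasDepth p n r := by
  obtain ⟨x, z, hxz⟩ := exists_minMax p n
  have hlt := hxz.head_lt hs
  have hne : x ≠ z := by rintro rfl; exact lt_irrefl _ hlt
  have hex := hp.exists_head_ne hne (n + 1)
  classical
  exact ⟨Nat.find hex, x, z, hxz, hlt, fun t ht => not_not.1 (Nat.find_min hex ht),
    Nat.find_spec hex⟩

theorem hasDepth_ge (hp : WanderingTriple p) {n r s : ℕ} {x z : Fin 3} (hr : HasDepth p n r)
    (hxz : MinMax p n x z) (h : ∀ t < s, p x (n + 1 + t) = p z (n + 1 + t)) : s ≤ r := by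
  obtain ⟨x', z', hxz', -, -, hne⟩ := hr
  obtain rfl : x = x' := hp.orbit_injective n (le_antisymm (hxz x').1 (hxz' x).1)
  obtain rfl : z = z' := hp.orbit_injective n (le_antisymm (hxz' z).2 (hxz z').2)
  by_contra! hlt
  exact hne (h r hlt)

/-- If the triple at time `n` straddles the triple at time `m` around the place where the first
entries split, then the next triple of `n` is nested in a gap of that of `m`. -/
theorem nested_of_lt (hp : WanderingTriple p) {n m : ℕ} (hnm : n ≠ m) {x z x' z' : Fin 3}
    (hxz : MinMax p n x z) (hlt : p x n < p z n) (hlt' : p x' m < p z' m)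
    (h : toLex (orbit p (n + 1) x) < toLex (orbit p (m + 1) x')) (v : Fin 3) :
    toLex (orbit p (m + 1) z') < toLex (orbit p (n + 1) v) ∧
      toLex (orbit p (n + 1) v) < toLex (orbit p (m + 1) x') := by
  obtain ⟨d, hd⟩ : ∃ d, p x' m + d = p x n := ⟨p x n - p x' m, by ring⟩
  have hz := hp.head_le n z x
  have hz' := hp.head_le m z' x'
  have key := hp.not_alternating n m 0 d (by simp [hnm])
  have key' := hp.not_alternating m n d 0 (by simp [hnm.symm])
  have ne' := hp.ne n m 0 d (by simp [hnm])
  simp only [addHead_zero] at key key' ne'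
  have lt_iff : ∀ i j, toLex (orbit p n i) < toLex (addHead d (orbit p m j)) ↔
      p i n < p j m + d ∨
        (p i n = p j m + d ∧ toLex (orbit p (n + 1) i) < toLex (orbit p (m + 1) j)) := by
    intro i j
    rw [toLex_lt_iff_head_tail]
    simp
  have gt_iff : ∀ i j, toLex (addHead d (orbit p m j)) < toLex (orbit p n i) ↔
      p j m + d < p i n ∨
        (p j m + d = p i n ∧ toLex (orbit p (m + 1) j) < toLex (orbit p (n + 1) i)) := by
    intro i j
    rw [toLex_lt_iff_head_tail]
    simp
  have tri : ∀ i j, toLex (orbit p n i) < toLex (addHead d (orbit p m j)) ∨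
      toLex (addHead d (orbit p m j)) < toLex (orbit p n i) := fun i j =>
    lt_or_gt_of_ne fun h => ne' i j (toLex.injective h)
  have hxx' : toLex (orbit p n x) < toLex (addHead d (orbit p m x')) :=
    (lt_iff _ _).2 (Or.inr ⟨hd.symm, h⟩)
  have hx'z : toLex (addHead d (orbit p m x')) < toLex (orbit p n z) :=
    (gt_iff _ _).2 (Or.inl (by omega))
  have hz'z : toLex (addHead d (orbit p m z')) < toLex (orbit p n z) :=
    (tri z z').resolve_left (key x z x' z' hxx' hx'z)
  have hz'z_tail : toLex (orbit p (m + 1) z') < toLex (orbit p (n + 1) z) := by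
    rcases (gt_iff _ _).1 hz'z with h' | h'
    · omega
    · exact h'.2
  have hzx := hp.shift_lt_of_head_lt hlt
  have hv : toLex (orbit p n v) < toLex (addHead d (orbit p m x')) ∨
      toLex (addHead d (orbit p m z')) < toLex (orbit p n v) := by
    by_contra! hc
    have h1 := (tri v x').resolve_left hc.1
    have h2 := (tri v z').resolve_right hc.2
    exact key' x' z' v z h1 h2 hz'z
  have hvx : p x n = p v n ∨ p x n < p v n := by
    rcases (hxz v).1.lt_or_eq with h' | h'
    · exact (head_le_of_orbit_lt h').eq_or_lt
    · exact Or.inl (congrFun (toLex.injective h') 0)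
  have hvz := hp.head_le n v x
  rcases hvx with hvx | hvx
  · have hxv : toLex (orbit p (n + 1) x) ≤ toLex (orbit p (n + 1) v) :=
      not_lt.1 fun h' => absurd ((orbit_lt_iff_of_head_eq hvx.symm).2 h') (not_lt.2 (hxz v).1)
    refine ⟨hz'z_tail.trans (hzx.trans_le hxv), ?_⟩
    rcases hv with hv | hv
    · rcases (lt_iff _ _).1 hv with h' | h'
      · omega
      · exact h'.2
    · rcases (gt_iff _ _).1 hv with h' | h' <;> omega
  · refine ⟨?_, (hp.shift_lt_of_head_lt hvx).trans h⟩
    rcases hv with hv | hv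
    · rcases (lt_iff _ _).1 hv with h' | h' <;> omega
    · rcases (gt_iff _ _).1 hv with h' | h'
      · omega
      · exact h'.2

/-- Of two splitting times, one has a next triple nested in a gap of the other, so that its points
share as many further entries as the depth of the other. -/
theorem agree_or_agree (hp : WanderingTriple p) {n m r s : ℕ} (hnm : n ≠ m)
    (hr : HasDepth p n r) (hs : HasDepth p m s) :
    (∀ i j, ∀ t < s, p i (n + 1 + t) = p j (n + 1 + t)) ∨
      (∀ i j, ∀ t < r, p i (m + 1 + t) = p j (m + 1 + t)) := by
  obtain ⟨x, z, hxz, hlt, hag, -⟩ := hr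
  obtain ⟨x', z', hxz', hlt', hag', -⟩ := hs
  have hne : toLex (orbit p (n + 1) x) ≠ toLex (orbit p (m + 1) x') := fun h => by
    have := hp.ne (n + 1) (m + 1) 0 0 (by simpa using hnm) x x'
    simp only [addHead_zero] at this
    exact this (toLex.injective h)
  rcases lt_or_gt_of_ne hne with h | h
  · left
    have pre : ∀ v, ∀ t < s, p v (n + 1 + t) = p z' (m + 1 + t) := fun v =>
      have hv := hp.nested_of_lt hnm hxz hlt hlt' h v
      eq_prefix_of_between hv.1 hv.2 fun t ht => (hag' t ht).symm
    exact fun i j t ht => (pre i t ht).trans (pre j t ht).symm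
  · right
    have pre : ∀ v, ∀ t < r, p v (m + 1 + t) = p z (n + 1 + t) := fun v =>
      have hv := hp.nested_of_lt hnm.symm hxz' hlt' hlt h v
      eq_prefix_of_between hv.1 hv.2 fun t ht => (hag t ht).symm
    exact fun i j t ht => (pre i t ht).trans (pre j t ht).symm

/-- At a splitting time two points share their first entry and are not separated by the third. -/
theorem exists_head_eq_not_separates (hp : WanderingTriple p) {m : ℕ} (hs : Splits p m) :
    ∃ i u w, i ≠ u ∧ w ≠ i ∧ w ≠ u ∧ p i m = p u m ∧ ¬ Separates p m w i u := by
  obtain ⟨x, z, hxz⟩ := exists_minMax p m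
  have hlt := hxz.head_lt hs
  have hne : x ≠ z := by rintro rfl; exact lt_irrefl _ hlt
  obtain ⟨i, hix, hiz⟩ : ∃ i, i ≠ x ∧ i ≠ z := by
    clear hlt hxz
    revert x z
    decide
  have hxi := head_le_of_orbit_lt ((hxz i).1.lt_of_ne ((hp.orbit_injective m).ne hix.symm))
  have hiz' := head_le_of_orbit_lt ((hxz i).2.lt_of_ne ((hp.orbit_injective m).ne hiz))
  have hzx := hp.head_le m z x
  by_cases h : p i m = p x m
  · refine ⟨i, x, z, hix, hiz.symm, hne.symm, h, ?_⟩
    rintro (hc | hc)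
    · exact absurd hc.2 (not_lt.2 (hxz x).2)
    · exact absurd hc.2 (not_lt.2 (hxz i).2)
  · refine ⟨i, z, x, hiz, hix.symm, hne, by omega, ?_⟩
    rintro (hc | hc)
    · exact absurd hc.1 (not_lt.2 (hxz i).1)
    · exact absurd hc.1 (not_lt.2 (hxz z).1)

/-- If the points of the triple following a late splitting time `m` share `r` entries, then an
earlier splitting time has depth more than `r`. -/
theorem exists_deeper (hp : WanderingTriple p) (N : ℕ) : ∃ M, ∀ m r, M ≤ m → Splits p m →
    (∀ i j, ∀ t < r, p i (m + 1 + t) = p j (m + 1 + t)) →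
    ∃ k, N ≤ k ∧ k < m ∧ ∃ s, r < s ∧ HasDepth p k s := by
  have hdiff : ∀ q : {q : Fin 3 × Fin 3 // q.1 ≠ q.2}, ∃ t, p q.1.1 (N + t) ≠ p q.1.2 (N + t) :=
    fun q => hp.exists_head_ne q.2 N
  choose f hf using hdiff
  obtain ⟨B, hB⟩ := (Set.finite_range f).bddAbove
  refine ⟨N + B + 1, fun m r hm hs hag => ?_⟩
  obtain ⟨i, u, w, hiu, hwi, hwu, heq, hsep⟩ := hp.exists_head_eq_not_separates hs
  have hfB : f ⟨(i, u), hiu⟩ ≤ B := hB ⟨_, rfl⟩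
  have hf' : p i (N + f ⟨(i, u), hiu⟩) ≠ p u (N + f ⟨(i, u), hiu⟩) := hf ⟨(i, u), hiu⟩
  classical
  set k := Nat.findGreatest (fun k => p i k ≠ p u k) m
  have hfm : N + f ⟨(i, u), hiu⟩ ≤ m := by omega
  have hNk : N ≤ k := (Nat.le_add_right _ _).trans (Nat.le_findGreatest hfm hf')
  have hne : p i k ≠ p u k := Nat.findGreatest_spec (P := fun k => p i k ≠ p u k) hfm hf'
  have hkm : k < m :=
    lt_of_le_of_ne (Nat.findGreatest_le m) fun h => hne (by rw [h]; exact heq)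
  have hafter : ∀ t, k < t → t ≤ m → p i t = p u t := fun t h1 h2 =>
    not_not.1 (Nat.findGreatest_is_greatest h1 h2)
  have hnsep : ∀ d, k + 1 + d ≤ m →
      ¬ Separates p (k + 1) w i u ∨ Separates p (k + 1 + d) w i u := by
    intro d
    induction d with
    | zero => exact fun _ => (em _).symm
    | succ d ih =>
      intro hd
      exact (ih (by omega)).imp_right fun h =>
        Separates.succ h (hafter (k + 1 + d) (by omega) (by omega))
  have hnsep' : ¬ Separates p (k + 1) w i u := by
    obtain ⟨d, hd⟩ : ∃ d, m = k + 1 + d := ⟨m - (k + 1), by omega⟩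
    exact (hnsep d hd.ge).resolve_right (hd ▸ hsep)
  have hsk := (hp.separates_or_separates_succ hwi hwu hne).resolve_right hnsep'
  obtain ⟨s, hs⟩ := hp.exists_hasDepth ⟨i, u, hne⟩
  refine ⟨k, hNk, hkm, s, ?_, hs⟩
  have hag' : ∀ t < r + 1, p i (k + 1 + t) = p u (k + 1 + t) := by
    intro t ht
    rcases le_or_gt (k + 1 + t) m with h | h
    · exact hafter _ (by omega) h
    · obtain ⟨t', ht'⟩ : ∃ t', k + 1 + t = m + 1 + t' := ⟨k + 1 + t - (m + 1), by omega⟩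
      rw [ht']
      exact hag i u t' (by omega)
  rcases hsk.minMax with h | h
  · exact hp.hasDepth_ge hs h hag'
  · exact hp.hasDepth_ge hs h fun t ht => (hag' t ht).symm

theorem exists_hasDepth_ge (hp : WanderingTriple p) (N : ℕ) : ∃ n r, N ≤ n ∧ HasDepth p n r := by
  obtain ⟨t, ht⟩ := hp.exists_head_ne (show (0 : Fin 3) ≠ 1 by decide) N
  obtain ⟨r, hr⟩ := hp.exists_hasDepth ⟨0, 1, ht⟩
  exact ⟨N + t, r, by omega, hr⟩

/-- Depths are unbounded: otherwise two late triples of the largest recurring depth are nested,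
which produces a larger depth. -/
theorem depth_unbounded (hp : WanderingTriple p) :
    ¬ ∃ R N, ∀ n r, N ≤ n → HasDepth p n r → r ≤ R := by
  intro hex
  classical
  obtain ⟨N, hN⟩ := Nat.find_spec hex
  set R := Nat.find hex
  obtain ⟨M, hM⟩ := hp.exists_deeper N
  have often : ∀ K, ∃ n r, K ≤ n ∧ HasDepth p n r ∧ R ≤ r := by
    intro K
    rcases Nat.eq_zero_or_pos R with h0 | hpos
    · obtain ⟨n, r, hn, hr⟩ := hp.exists_hasDepth_ge K
      exact ⟨n, r, hn, hr, by omega⟩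
    · by_contra! hc
      refine Nat.find_min hex (m := R - 1) (by omega) ⟨K, fun n r hn hr => ?_⟩
      have := hc n r hn hr
      omega
  obtain ⟨n, r, hn, hr, hRr⟩ := often M
  obtain ⟨m, s, hm, hs, hRs⟩ := often (n + 1)
  have contra : ∀ m, M ≤ m → Splits p m →
      ¬ ∀ i j, ∀ t < R, p i (m + 1 + t) = p j (m + 1 + t) := by
    intro m hm hs hag
    obtain ⟨k, hNk, -, s, hRs, hks⟩ := hM m R hm hs hag
    exact absurd (hN k s hNk hks) (not_le.2 hRs)
  rcases hp.agree_or_agree (by omega) hr hs with h | h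
  · exact contra n hn hr.splits fun i j t ht => h i j t (by omega)
  · exact contra m (by omega) hs.splits fun i j t ht => h i j t (by omega)

/-- Depths are bounded: otherwise the first late triple of record depth is nested in an earlier one,
which produces an earlier record. -/
theorem depth_bounded (hp : WanderingTriple p) :
    ∃ R N, ∀ n r, N ≤ n → HasDepth p n r → r ≤ R := by
  by_contra! hunb
  obtain ⟨M, hM⟩ := hp.exists_deeper 0
  obtain ⟨n₀, r₀, hMn₀, h₀⟩ := hp.exists_hasDepth_ge M
  classical
  have hdepth : ∀ n, Splits p n → ∃ r, HasDepth p n r := fun n h => hp.exists_hasDepth h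
  choose! ρ hρ using hdepth
  have depth_le : ∀ {n r s}, HasDepth p n r → HasDepth p n s → r ≤ s := fun hr hs => by
    obtain ⟨x, z, hxz, -, hag, -⟩ := hr
    exact hp.hasDepth_ge hs hxz hag
  obtain ⟨n, hn, hmax⟩ := Finset.exists_max_image
    ((Finset.range (n₀ + 1)).filter (Splits p)) ρ ⟨n₀, by simp [h₀.splits]⟩
  simp only [Finset.mem_filter, Finset.mem_range] at hn hmax
  have hex : ∃ m, Splits p m ∧ ρ n < ρ m := by
    obtain ⟨m, s, -, hs, hlt⟩ := hunb (ρ n) 0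
    exact ⟨m, hs.splits, hlt.trans_le (depth_le hs (hρ m hs.splits))⟩
  -- The first time at which the depth exceeds all depths up to time `n₀`.
  obtain ⟨hms, hlt⟩ := Nat.find_spec hex
  set m := Nat.find hex
  have hm₀ : n₀ < m := by
    by_contra hc
    have := hmax m ⟨by omega, hms⟩
    omega
  have hnm : n ≠ m := by omega
  rcases hp.agree_or_agree hnm (hρ n hn.2) (hρ m hms) with h | h
  · exact absurd ((hρ n hn.2).le_of_agree h) (not_le.2 hlt)
  · have hMm : M ≤ m := by omega
    obtain ⟨k, -, hkm, s, hs, hks⟩ := hM m (ρ n) hMm hms h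
    exact Nat.find_min hex hkm ⟨hks.splits, hs.trans_le (depth_le hks (hρ k hks.splits))⟩

end WanderingTriple

theorem wanderingTriple_of_mem {A : Set Addr} {p : Fin 3 → Addr} (hpA : ∀ i, p i ∈ A)
    (hp : Function.Injective p)
    (hA : ∀ (n₁ n₂ : ℕ) (m₁ m₂ : ℤ), (n₁, m₁) ≠ (n₂, m₂) →
      Unlinked (translateSet m₁ (shiftSet n₁ A)) (translateSet m₂ (shiftSet n₂ A))) :
    WanderingTriple p := by
  have mem : ∀ n m i, addHead m (orbit p n i) ∈ translateSet m (shiftSet n A) := fun n m i =>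
    ⟨orbit p n i, ⟨p i, hpA i, shift_iterate n (p i)⟩, rfl⟩
  refine ⟨hp, fun n₁ n₂ m₁ m₂ h i j heq => ?_, fun n₁ n₂ m₁ m₂ h i i' j j' h1 h2 h3 => ?_⟩
  · exact Set.disjoint_left.1 (hA n₁ n₂ m₁ m₂ h).1 (mem n₁ m₁ i) (heq ▸ mem n₂ m₂ j)
  · exact (hA n₁ n₂ m₁ m₂ h).2
      ⟨_, mem n₁ m₁ i, _, mem n₁ m₁ i', _, mem n₂ m₂ j, _, mem n₂ m₂ j', Or.inl ⟨h1, h2, h3⟩⟩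

/-- **No wandering triangles.** There is no wandering gap of exponential combinatorial
type: no set `A ⊆ ℤ^ℕ` such that `σⁿ(A)` has at least three elements for every `n ≥ 0` and
such that the translates `σ^{n₁}(A) + m₁` and `σ^{n₂}(A) + m₂` are disjoint and unlinked
whenever `(n₁, m₁) ≠ (n₂, m₂)`. -/
theorem no_wandering_gaps :
    ¬ ∃ A : Set Addr,
      (∀ n : ℕ, ∃ a ∈ shiftSet n A, ∃ b ∈ shiftSet n A, ∃ c ∈ shiftSet n A,
        a ≠ b ∧ a ≠ c ∧ b ≠ c) ∧
      (∀ (n₁ n₂ : ℕ) (m₁ m₂ : ℤ), (n₁, m₁) ≠ (n₂, m₂) →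
        Unlinked (translateSet m₁ (shiftSet n₁ A)) (translateSet m₂ (shiftSet n₂ A))) := by
  rintro ⟨A, h3, hA⟩
  obtain ⟨_, ⟨a, ha, rfl⟩, _, ⟨b, hb, rfl⟩, _, ⟨c, hc, rfl⟩, hab, hac, hbc⟩ := h3 0
  simp only [Function.iterate_zero, id_eq] at hab hac hbc
  have hmem : ∀ i, ![a, b, c] i ∈ A := by
    intro i
    fin_cases i <;> assumption
  have hp := wanderingTriple_of_mem hmem (by
    intro i j h
    fin_cases i <;> fin_cases j <;> simp_all [eq_comm]) hA
  exact hp.depth_unbounded hp.depth_bounded
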